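/- Let H be a noetherian Hopf algebra over a field k with bijective antipode. Then l.Ggldim(H) = l.silp(H) = l.spli(H) = id_H(H), where id_H(H) is the injective dimension of the left regular module H. -/

import Mathlib

open TensorProduct

universe u

noncomputable section GorensteinCore

/-- `ProjDimLE R n M` : the left `R`-module `M` has a projective resolution of length `≤ n`. -/
def ProjDimLE (R : Type u) [Ring R] : ℕ → (M : Type u) → [AddCommGroup M] → [Module R M] → Prop
  | 0, M, _, _ => Module.Projective R M
  | (n+1), M, _, _ => Module.Projective R M ∨
      ∃ (P : ModuleCat.{u} R) (f : P →ₗ[R] M), Module.Projective R P ∧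
      Function.Surjective f ∧ ProjDimLE R n (LinearMap.ker f)

/-- The projective dimension of a module, as an element of `ℕ∞` (`⊤` = infinite). -/
def projDim (R : Type u) [Ring R] (M : Type u) [AddCommGroup M] [Module R M] : ℕ∞ :=
  sInf {n : ℕ∞ | ∃ m : ℕ, n = (m : ℕ∞) ∧ ProjDimLE R m M}

/-- A module is Gorenstein projective if it is a syzygy of a totally acyclic complex of
projective modules. -/
def IsGorensteinProjective (R : Type u) [Ring R] (M : Type u) [AddCommGroup M] [Module R M] :
    Prop :=
  ∃ (P : ℤ → ModuleCat.{u} R) (d : ∀ i : ℤ, P (i+1) →ₗ[R] P i),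
    (∀ i, Module.Projective R (P i)) ∧
    (∀ i, LinearMap.range (d (i+1)) = LinearMap.ker (d i)) ∧
    (∀ (Q : ModuleCat.{u} R), Module.Projective R Q →
      ∀ (i : ℤ) (f : P (i+1) →ₗ[R] Q), f.comp (d (i+1)) = 0 →
        ∃ g : P i →ₗ[R] Q, g.comp (d i) = f) ∧
    Nonempty (M ≃ₗ[R] LinearMap.ker (d 0))

/-- `GProjDimLE R n M` : `M` has a Gorenstein projective resolution of length `≤ n`. -/
def GProjDimLE (R : Type u) [Ring R] : ℕ → (M : Type u) → [AddCommGroup M] → [Module R M] → Prop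
  | 0, M, _, _ => IsGorensteinProjective R M
  | (n+1), M, _, _ => IsGorensteinProjective R M ∨
      ∃ (G : ModuleCat.{u} R) (f : G →ₗ[R] M), IsGorensteinProjective R G ∧
      Function.Surjective f ∧ GProjDimLE R n (LinearMap.ker f)

/-- The Gorenstein projective dimension of a module, as an element of `ℕ∞`. -/
def gProjDim (R : Type u) [Ring R] (M : Type u) [AddCommGroup M] [Module R M] : ℕ∞ :=
  sInf {n : ℕ∞ | ∃ m : ℕ, n = (m : ℕ∞) ∧ GProjDimLE R m M}

/-- The (left) Gorenstein global dimension of a ring `R`. -/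
def lGgldim (R : Type u) [Ring R] : ℕ∞ :=
  ⨆ M : ModuleCat.{u} R, gProjDim R M

/-- The (left) global dimension of a ring `R`. -/
def lgldim (R : Type u) [Ring R] : ℕ∞ :=
  ⨆ M : ModuleCat.{u} R, projDim R M

/-- `InjDimLE R n M` : the left `R`-module `M` has an injective resolution of length `≤ n`. -/
def InjDimLE (R : Type u) [Ring R] : ℕ → (M : Type u) → [AddCommGroup M] → [Module R M] → Prop
  | 0, M, _, _ => Module.Injective R M
  | (n+1), M, _, _ => Module.Injective R M ∨
      ∃ (I : ModuleCat.{u} R) (f : M →ₗ[R] I), Module.Injective R I ∧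
      Function.Injective f ∧ InjDimLE R n (I ⧸ LinearMap.range f)

/-- The injective dimension of a module, as an element of `ℕ∞`. -/
def injDim (R : Type u) [Ring R] (M : Type u) [AddCommGroup M] [Module R M] : ℕ∞ :=
  sInf {n : ℕ∞ | ∃ m : ℕ, n = (m : ℕ∞) ∧ InjDimLE R m M}

/-- `silp R` : the supremum of the injective dimensions of projective left `R`-modules. -/
def silp (R : Type u) [Ring R] : ℕ∞ :=
  ⨆ (M : ModuleCat.{u} R) (_ : Module.Projective R M), injDim R M

/-- `spli R` : the supremum of the projective dimensions of injective left `R`-modules. -/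
def spli (R : Type u) [Ring R] : ℕ∞ :=
  ⨆ (M : ModuleCat.{u} R) (_ : Module.Injective R M), projDim R M

end GorensteinCore
noncomputable section HopfCore

variable (k : Type u) [CommRing k] (H : Type u) [Ring H] [HopfAlgebra k H]

/-- The trivial left `H`-module structure on `k`, given by the counit. -/
def trivModule : Module H k :=
  Module.compHom k ((Bialgebra.counitAlgHom k H : H →ₐ[k] k) : H →+* k)

/-- The trivial left `H`-module `εk`, as an object of `ModuleCat H`. -/
def trivMod : ModuleCat.{u} H :=
  @ModuleCat.of H _ k _ (trivModule k H)

/-- The counit of `H`, as a ring homomorphism out of `Hᵐᵒᵖ`. -/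
def counitOp : Hᵐᵒᵖ →+* k :=
  RingHom.fromOpposite ((Bialgebra.counitAlgHom k H : H →ₐ[k] k) : H →+* k)
    (fun _ _ => mul_comm _ _)

/-- The trivial right `H`-module structure on `k` (as a left `Hᵐᵒᵖ`-module). -/
def trivModuleOp : Module Hᵐᵒᵖ k :=
  Module.compHom k (counitOp k H)

/-- The trivial right `H`-module `k_ε`, as an object of `ModuleCat Hᵐᵒᵖ`. -/
def trivModOp : ModuleCat.{u} Hᵐᵒᵖ :=
  @ModuleCat.of Hᵐᵒᵖ _ k _ (trivModuleOp k H)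

section TensorAction

variable (M N : Type u) [AddCommGroup M] [Module k M] [Module H M]
  [IsScalarTower k H M] [SMulCommClass k H M]
  [AddCommGroup N] [Module k N] [Module H N] [IsScalarTower k H N] [SMulCommClass k H N]

/-- The representation of `H` on a left `H`-module `M`, as an algebra morphism to
`End_k(M)`. -/
def hRep : H →ₐ[k] Module.End k M :=
  (Algebra.lsmul k k M : H →ₐ[k] Module.End k M)

/-- The representation of `H` on `M ⊗[k] N` given by the comultiplication of `H`:
`h • (m ⊗ n) = ∑ h₁ • m ⊗ h₂ • n`. -/
def tensorRep : H →ₐ[k] Module.End k (M ⊗[k] N) :=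
  ((Module.endTensorEndAlgHom (R := k) (S := k) (A := k) (M := M) (N := N)).comp
    (Algebra.TensorProduct.map (hRep k H M) (hRep k H N))).comp
    (Bialgebra.comulAlgHom k H)

/-- The diagonal left `H`-module structure on `M ⊗[k] N`:
`h • (m ⊗ n) = ∑ h₁ • m ⊗ h₂ • n`. -/
def tensorModule : Module H (M ⊗[k] N) :=
  Module.compHom (M ⊗[k] N)
    ((tensorRep k H M N).toRingHom : H →+* Module.End k (M ⊗[k] N))

/-- The tensor product `M ⊗[k] N` with its diagonal left `H`-module structure, as an
object of `ModuleCat H`. -/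
def tensorMod : ModuleCat.{u} H :=
  @ModuleCat.of H _ (M ⊗[k] N) _ (tensorModule k H M N)

end TensorAction

end HopfCore

section ExtVanishing

open CategoryTheory Abelian

/-- `ExtVanish R i M Q` : the group `Ext^i_R(M, Q)` is trivial. -/
def ExtVanish (R : Type u) [Ring R] (i : ℕ) (M Q : Type u) [AddCommGroup M] [Module R M]
    [AddCommGroup Q] [Module R Q] : Prop :=
  Subsingleton (Ext (ModuleCat.of R M) (ModuleCat.of R Q) i)

variable {R : Type u} [Ring R] {A P B Q M : Type u}
  [AddCommGroup A] [Module R A] [AddCommGroup P] [Module R P] [AddCommGroup B] [Module R B]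
  [AddCommGroup Q] [Module R Q] [AddCommGroup M] [Module R M]

theorem ExtVanish.of_projective [Module.Projective R P] (i : ℕ) : ExtVanish R (i + 1) P Q :=
  have : Projective (ModuleCat.of R P) := ModuleCat.projective_of_categoryTheory_projective _
  ⟨fun x y => by rw [Ext.eq_zero_of_projective x, Ext.eq_zero_of_projective y]⟩

theorem ExtVanish.of_injective [Module.Injective R Q] (i : ℕ) : ExtVanish R (i + 1) M Q :=
  have : Injective (ModuleCat.of R Q) := Module.injective_object_of_injective_module R Q
  ⟨fun x y => by rw [Ext.eq_zero_of_injective x, Ext.eq_zero_of_injective y]⟩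

theorem ExtVanish.projective (h : ∀ N : ModuleCat.{u} R, ExtVanish R 1 M N) :
    Module.Projective R M := by
  rw [IsProjective.iff_projective, projective_iff_subsingleton_ext_one]
  exact fun N => h N

theorem ExtVanish.injective (h : ∀ N : ModuleCat.{u} R, ExtVanish R 1 N Q) :
    Module.Injective R Q := by
  rw [Module.injective_iff_injective_object, injective_iff_subsingleton_ext_one]
  exact fun N => h N

theorem ExtVanish.mono_right {n m : ℕ} (hnm : n ≤ m)
    (h : ∀ N : ModuleCat.{u} R, ExtVanish R n N Q) : ExtVanish R m M Q := by
  have := hasInjectiveDimensionLT_of_enoughProjectives (ModuleCat.of R Q) n h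
  exact HasInjectiveDimensionLT.subsingleton (ModuleCat.of R Q) n m hnm _

theorem ExtVanish.mono_left {n m : ℕ} (hnm : n ≤ m)
    (h : ∀ N : ModuleCat.{u} R, ExtVanish R n M N) : ExtVanish R m M Q := by
  have := hasProjectiveDimensionLT_of_enoughInjectives (ModuleCat.of R M) n h
  exact HasProjectiveDimensionLT.subsingleton (ModuleCat.of R M) n m hnm _

theorem ExtVanish.of_retract_left {i : ℕ} (s : A →ₗ[R] P) (r : P →ₗ[R] A)
    (h : ∀ a, r (s a) = a) (hP : ExtVanish R i P Q) : ExtVanish R i A Q := by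
  have hrs : ModuleCat.ofHom s ≫ ModuleCat.ofHom r = 𝟙 (ModuleCat.of R A) := by
    ext a; exact h a
  refine ⟨fun x y => ?_⟩
  have key : ∀ z : Ext (ModuleCat.of R A) (ModuleCat.of R Q) i,
      z = (Ext.mk₀ (ModuleCat.ofHom s)).comp ((Ext.mk₀ (ModuleCat.ofHom r)).comp z (zero_add i))
        (zero_add i) := by
    intro z
    rw [← Ext.comp_assoc_of_second_deg_zero, Ext.mk₀_comp_mk₀, hrs, Ext.mk₀_id_comp]
  rw [key x, key y, hP.elim ((Ext.mk₀ (ModuleCat.ofHom r)).comp x (zero_add i)) _]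

theorem ExtVanish.of_retract_right {i : ℕ} (s : A →ₗ[R] P) (r : P →ₗ[R] A)
    (h : ∀ a, r (s a) = a) (hP : ExtVanish R i M P) : ExtVanish R i M A := by
  have hrs : ModuleCat.ofHom s ≫ ModuleCat.ofHom r = 𝟙 (ModuleCat.of R A) := by
    ext a; exact h a
  refine ⟨fun x y => ?_⟩
  have key : ∀ z : Ext (ModuleCat.of R M) (ModuleCat.of R A) i,
      z = (z.comp (Ext.mk₀ (ModuleCat.ofHom s)) (add_zero i)).comp (Ext.mk₀ (ModuleCat.ofHom r))
        (add_zero i) := by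
    intro z
    rw [Ext.comp_assoc_of_third_deg_zero, Ext.mk₀_comp_mk₀, hrs, Ext.comp_mk₀_id]
  rw [key x, key y, hP.elim (x.comp (Ext.mk₀ (ModuleCat.ofHom s)) (add_zero i)) _]

variable (f : A →ₗ[R] P) (g : P →ₗ[R] B) (hf : Function.Injective f)
  (hfg : Function.Exact f g) (hg : Function.Surjective g)

include hf hfg hg

theorem moduleCat_shortExact : (ShortComplex.mk (ModuleCat.ofHom f) (ModuleCat.ofHom g)
    (by ext x; exact hfg.apply_apply_eq_zero x)).ShortExact :=
  ModuleCat.shortComplex_shortExact _ hfg hf hg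

theorem ExtVanish.right_of_left {i : ℕ} (hA : ExtVanish R i A Q)
    (hP : ExtVanish R (i + 1) P Q) : ExtVanish R (i + 1) B Q := by
  have hS := moduleCat_shortExact f g hf hfg hg
  have key : ∀ x : Ext (ModuleCat.of R B) (ModuleCat.of R Q) (i + 1), x = 0 := by
    intro x
    obtain ⟨y, rfl⟩ := Ext.contravariant_sequence_exact₃ hS _ x (hP.elim _ _) (add_comm 1 i)
    rw [hA.elim y 0, Ext.comp_zero]
  exact ⟨fun x y => by rw [key x, key y]⟩

theorem ExtVanish.left_of_right {i : ℕ} (hB : ExtVanish R (i + 1) B Q)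
    (hP : ExtVanish R i P Q) : ExtVanish R i A Q := by
  have hS := moduleCat_shortExact f g hf hfg hg
  have key : ∀ x : Ext (ModuleCat.of R A) (ModuleCat.of R Q) i, x = 0 := by
    intro x
    obtain ⟨y, rfl⟩ := Ext.contravariant_sequence_exact₁ hS _ x (add_comm 1 i) (hB.elim _ _)
    rw [hP.elim y 0, Ext.comp_zero]
  exact ⟨fun x y => by rw [key x, key y]⟩

theorem ExtVanish.sub_of_quotient {i : ℕ} (hB : ExtVanish R i M B)
    (hP : ExtVanish R (i + 1) M P) : ExtVanish R (i + 1) M A := by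
  have hS := moduleCat_shortExact f g hf hfg hg
  have key : ∀ x : Ext (ModuleCat.of R M) (ModuleCat.of R A) (i + 1), x = 0 := by
    intro x
    obtain ⟨y, rfl⟩ := Ext.covariant_sequence_exact₁ _ hS x (hP.elim _ _) rfl
    rw [hB.elim y 0, Ext.zero_comp]
  exact ⟨fun x y => by rw [key x, key y]⟩

theorem ExtVanish.quotient_of_sub {i : ℕ} (hA : ExtVanish R (i + 1) M A)
    (hP : ExtVanish R i M P) : ExtVanish R i M B := by
  have hS := moduleCat_shortExact f g hf hfg hg
  have key : ∀ x : Ext (ModuleCat.of R M) (ModuleCat.of R B) i, x = 0 := by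
    intro x
    obtain ⟨y, rfl⟩ := Ext.covariant_sequence_exact₃ _ hS x rfl (hA.elim _ _)
    rw [hP.elim y 0, Ext.zero_comp]
  exact ⟨fun x y => by rw [key x, key y]⟩

theorem ExtVanish.exists_extension (hB : ExtVanish R 1 B Q) (a : A →ₗ[R] Q) :
    ∃ b : P →ₗ[R] Q, b ∘ₗ f = a := by
  have hS := moduleCat_shortExact f g hf hfg hg
  obtain ⟨φ, hφ⟩ := Ext.contravariant_sequence_exact₁ hS _ (Ext.mk₀ (ModuleCat.ofHom a))
    (add_zero 1) (hB.elim _ _)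
  obtain ⟨φ, rfl⟩ := Ext.homEquiv₀.symm.surjective φ
  have h : ModuleCat.ofHom f ≫ φ = ModuleCat.ofHom a :=
    Ext.homEquiv₀.symm.injective (by simpa using hφ)
  exact ⟨φ.hom, by ext x; exact congr($h x)⟩

theorem ExtVanish.of_exists_extension [Module.Projective R P]
    (h : ∀ a : A →ₗ[R] Q, ∃ b : P →ₗ[R] Q, b ∘ₗ f = a) : ExtVanish R 1 B Q := by
  have hS := moduleCat_shortExact f g hf hfg hg
  have key : ∀ x : Ext (ModuleCat.of R B) (ModuleCat.of R Q) 1, x = 0 := by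
    intro x
    obtain ⟨y, rfl⟩ := Ext.contravariant_sequence_exact₃ hS _ x
      ((ExtVanish.of_projective 0).elim _ _) (add_zero 1)
    obtain ⟨φ, rfl⟩ := Ext.homEquiv₀.symm.surjective y
    obtain ⟨b, hb⟩ := h φ.hom
    have hφ : φ = ModuleCat.ofHom f ≫ ModuleCat.ofHom b := by
      ext x; exact congr($hb.symm x)
    have h0 : (hS.extClass.comp (Ext.mk₀ φ) (add_zero 1)) = 0 := by
      rw [hφ, ← Ext.mk₀_comp_mk₀, ← Ext.comp_assoc_of_second_deg_zero]
      have := hS.extClass_comp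
      dsimp only at this
      rw [this, Ext.zero_comp]
    exact h0
  exact ⟨fun x y => by rw [key x, key y]⟩

end ExtVanishing

section Bridges

variable {R : Type u} [Ring R]

theorem exact_mkQ_range {M N : Type u} [AddCommGroup M] [Module R M] [AddCommGroup N] [Module R N]
    (f : M →ₗ[R] N) : Function.Exact f (LinearMap.range f).mkQ := by
  rw [LinearMap.exact_iff, Submodule.ker_mkQ]

theorem exact_subtype_ker {M N : Type u} [AddCommGroup M] [Module R M] [AddCommGroup N] [Module R N]
    (f : M →ₗ[R] N) : Function.Exact (LinearMap.ker f).subtype f := by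
  rw [LinearMap.exact_iff, Submodule.range_subtype]

theorem exists_injective_embedding (M : Type u) [AddCommGroup M] [Module R M] :
    ∃ (I : ModuleCat.{u} R) (f : M →ₗ[R] I), Module.Injective R I ∧ Function.Injective f := by
  obtain ⟨⟨J, hJ, f, hf⟩⟩ := CategoryTheory.EnoughInjectives.presentation (ModuleCat.of R M)
  exact ⟨J, f.hom, Module.injective_module_of_injective_object R J,
    (ModuleCat.mono_iff_injective f).mp hf⟩

theorem exists_projective_cover (M : Type u) [AddCommGroup M] [Module R M] :
    ∃ (P : ModuleCat.{u} R) (f : P →ₗ[R] M), Module.Projective R P ∧ Function.Surjective f :=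
  ⟨ModuleCat.of R (M →₀ R), Finsupp.linearCombination R id, inferInstanceAs
    (Module.Projective R (M →₀ R)), fun m => ⟨Finsupp.single m 1, by simp⟩⟩

theorem injDimLE_iff (n : ℕ) (Q : Type u) [AddCommGroup Q] [Module R Q] :
    InjDimLE R n Q ↔ ∀ M : ModuleCat.{u} R, ExtVanish R (n + 1) M Q := by
  induction n generalizing Q with
  | zero => exact ⟨fun (h : Module.Injective R Q) M => .of_injective 0, ExtVanish.injective⟩
  | succ n ih =>
    constructor
    · rintro (h | ⟨I, f, hI, hf, h⟩) M
      · exact .of_injective _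
      · exact .sub_of_quotient f _ hf (exact_mkQ_range f) (Submodule.mkQ_surjective _)
          ((ih _).mp h M) (.of_injective _)
    · intro h
      obtain ⟨I, f, hI, hf⟩ := exists_injective_embedding (R := R) Q
      exact .inr ⟨I, f, hI, hf, (ih _).mpr fun M => .quotient_of_sub f _ hf (exact_mkQ_range f)
        (Submodule.mkQ_surjective _) (h M) (.of_injective _)⟩

theorem projDimLE_iff (n : ℕ) (M : Type u) [AddCommGroup M] [Module R M] :
    ProjDimLE R n M ↔ ∀ Q : ModuleCat.{u} R, ExtVanish R (n + 1) M Q := by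
  induction n generalizing M with
  | zero => exact ⟨fun (h : Module.Projective R M) Q => .of_projective 0, ExtVanish.projective⟩
  | succ n ih =>
    constructor
    · rintro (h | ⟨P, f, hP, hf, h⟩) Q
      · exact .of_projective _
      · exact .right_of_left _ f (Submodule.subtype_injective _) (exact_subtype_ker f) hf
          ((ih _).mp h Q) (.of_projective _)
    · intro h
      obtain ⟨P, f, hP, hf⟩ := exists_projective_cover (R := R) M
      exact .inr ⟨P, f, hP, hf, (ih _).mpr fun Q => .left_of_right _ f
        (Submodule.subtype_injective _) (exact_subtype_ker f) hf (h Q) (.of_projective _)⟩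

theorem IsGorensteinProjective.extVanish {G Q : Type u} [AddCommGroup G] [Module R G]
    [AddCommGroup Q] [Module R Q] [Module.Projective R Q] (h : IsGorensteinProjective R G) (j : ℕ) :
    ExtVanish R (j + 1) G Q := by
  obtain ⟨P, d, hP, hd, hQ, ⟨e⟩⟩ := h
  have surj (i : ℤ) : Function.Surjective ((d (i + 1)).codRestrict (LinearMap.ker (d i))
      fun x => by rw [← hd i]; exact ⟨x, rfl⟩) := by
    rintro ⟨y, hy⟩
    rw [← hd i] at hy
    obtain ⟨x, hx⟩ := hy
    exact ⟨x, Subtype.ext hx⟩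
  have ex (i : ℤ) : Function.Exact (LinearMap.ker (d (i + 1))).subtype
      ((d (i + 1)).codRestrict (LinearMap.ker (d i))
        fun x => by rw [← hd i]; exact ⟨x, rfl⟩) := by
    rw [LinearMap.exact_iff, LinearMap.ker_codRestrict, Submodule.range_subtype]
  have key : ∀ i : ℤ, ExtVanish R (j + 1) (LinearMap.ker (d i)) Q := by
    induction j with
    | zero =>
      intro i
      refine .of_exists_extension _ _ (Submodule.subtype_injective _) (ex i) (surj i) fun a => ?_
      obtain ⟨b, hb⟩ := hQ (ModuleCat.of R Q) inferInstance (i + 1 + 1)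
        (a ∘ₗ (d (i + 1 + 1)).codRestrict (LinearMap.ker (d (i + 1)))
          fun x => by rw [← hd (i + 1)]; exact ⟨x, rfl⟩) (by
          ext x
          have : d (i + 1 + 1) (d (i + 1 + 1 + 1) x) = 0 := by
            have : d (i + 1 + 1 + 1) x ∈ LinearMap.ker (d (i + 1 + 1)) := by
              rw [← hd (i + 1 + 1)]; exact ⟨x, rfl⟩
            exact this
          have h0 : (d (i + 1 + 1)).codRestrict (LinearMap.ker (d (i + 1)))
              (fun x => by rw [← hd (i + 1)]; exact ⟨x, rfl⟩) (d (i + 1 + 1 + 1) x) = 0 :=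
            Subtype.ext this
          exact (congrArg a h0).trans (map_zero a))
      refine ⟨b, LinearMap.ext fun x => ?_⟩
      obtain ⟨y, rfl⟩ := surj (i + 1) x
      exact congr($hb y)
    | succ j ih =>
      exact fun i => .right_of_left _ _ (Submodule.subtype_injective _) (ex i) (surj i)
        (ih (i + 1)) (.of_projective _)
  exact .of_retract_left e.toLinearMap e.symm.toLinearMap (by simp) (key 0)

theorem GProjDimLE.extVanish {n : ℕ} {M Q : Type u} [AddCommGroup M] [Module R M]
    [AddCommGroup Q] [Module R Q] [Module.Projective R Q] (h : GProjDimLE R n M) {m : ℕ}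
    (hm : n ≤ m) : ExtVanish R (m + 1) M Q := by
  induction n generalizing M m with
  | zero => exact IsGorensteinProjective.extVanish h m
  | succ n ih =>
    obtain h | ⟨G, f, hG, hf, h⟩ := h
    · exact h.extVanish m
    · obtain ⟨m, rfl⟩ : ∃ k, m = k + 1 := ⟨m - 1, by lia⟩
      exact .right_of_left _ f (Submodule.subtype_injective _) (exact_subtype_ker f) hf
        (ih h (by lia)) (hG.extVanish _)

theorem sInf_natCast_le_iff {p : ℕ → Prop} {n : ℕ} (hp : ∀ m, p m → m ≤ n → p n) :
    sInf {a : ℕ∞ | ∃ m : ℕ, a = (m : ℕ∞) ∧ p m} ≤ n ↔ p n := by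
  constructor
  · intro h
    have hne : {a : ℕ∞ | ∃ m : ℕ, a = (m : ℕ∞) ∧ p m}.Nonempty := by
      by_contra hne
      rw [Set.not_nonempty_iff_eq_empty] at hne
      rw [hne, sInf_empty] at h
      exact absurd h (by simp)
    obtain ⟨m, hm, hpm⟩ := csInf_mem hne
    rw [hm] at h
    exact hp m hpm (by exact_mod_cast h)
  · exact fun h => sInf_le ⟨n, rfl, h⟩

theorem exists_of_sInf_natCast_le {p : ℕ → Prop} {n : ℕ}
    (h : sInf {a : ℕ∞ | ∃ m : ℕ, a = (m : ℕ∞) ∧ p m} ≤ n) : ∃ m ≤ n, p m := by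
  have hsub : {a : ℕ∞ | ∃ m : ℕ, a = (m : ℕ∞) ∧ p m} ⊆
      {a : ℕ∞ | ∃ m : ℕ, a = (m : ℕ∞) ∧ ∃ m' ≤ m, p m'} :=
    fun _ ⟨m, h1, h2⟩ => ⟨m, h1, m, le_rfl, h2⟩
  exact (sInf_natCast_le_iff (p := fun n => ∃ m ≤ n, p m)
    fun _ ⟨m', h1, h2⟩ h3 => ⟨m', h1.trans h3, h2⟩).mp
    ((sInf_le_sInf hsub).trans h)

theorem injDim_le_iff (n : ℕ) (Q : Type u) [AddCommGroup Q] [Module R Q] :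
    injDim R Q ≤ n ↔ ∀ M : ModuleCat.{u} R, ExtVanish R (n + 1) M Q := by
  rw [← injDimLE_iff]
  refine sInf_natCast_le_iff fun m hm hmn => ?_
  rw [injDimLE_iff] at hm ⊢
  exact fun M => .mono_right (by lia) hm

theorem projDim_le_iff (n : ℕ) (M : Type u) [AddCommGroup M] [Module R M] :
    projDim R M ≤ n ↔ ∀ Q : ModuleCat.{u} R, ExtVanish R (n + 1) M Q := by
  rw [← projDimLE_iff]
  refine sInf_natCast_le_iff fun m hm hmn => ?_
  rw [projDimLE_iff] at hm ⊢
  exact fun M => .mono_left (by lia) hm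

theorem injDim_le_of_lGgldim_le {n : ℕ} (h : lGgldim R ≤ n) : injDim R R ≤ n := by
  rw [injDim_le_iff]
  intro M
  obtain ⟨m, hm, hM⟩ := exists_of_sInf_natCast_le ((le_iSup _ M).trans h)
  exact hM.extVanish hm

theorem injDim_le_silp : injDim R R ≤ silp R :=
  le_iSup₂ (f := fun (M : ModuleCat.{u} R) (_ : Module.Projective R M) => injDim R M)
    (ModuleCat.of R R) (inferInstanceAs (Module.Projective R R))

/-- The Baer criterion for the injective dimension. -/
theorem extVanish_of_baer {n : ℕ} {Q : Type u} [AddCommGroup Q] [Module R Q]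
    (h : ∀ J : Ideal R, ExtVanish R (n + 1) (R ⧸ J) Q) (M : ModuleCat.{u} R) :
    ExtVanish R (n + 1) M Q := by
  induction n generalizing Q M with
  | zero =>
    have : Module.Injective R Q := by
      rw [← Module.Baer.iff_injective]
      intro J g
      obtain ⟨b, hb⟩ := (h J).exists_extension J.subtype J.mkQ (Submodule.subtype_injective _)
        (by rw [LinearMap.exact_iff, Submodule.ker_mkQ, Submodule.range_subtype])
        (Submodule.mkQ_surjective _) g
      exact ⟨b, fun x hx => congr($hb ⟨x, hx⟩)⟩
    exact .of_injective 0
  | succ n ih =>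
    obtain ⟨I, f, hI, hf⟩ := exists_injective_embedding (R := R) Q
    exact .sub_of_quotient f _ hf (exact_mkQ_range f) (Submodule.mkQ_surjective _)
      (ih (fun J => .quotient_of_sub f _ hf (exact_mkQ_range f)
        (Submodule.mkQ_surjective _) (h J) (.of_injective _)) M) (.of_injective _)

end Bridges

section NoetherianTransfer

variable {R : Type u} [Ring R]

/-- Over a left noetherian ring, a bound on the injective dimension passes from one
module to another as soon as extension problems along submodules of finite free modules are solvable
for the latter whenever they are for the former. -/
theorem extVanish_of_extension_transfer [IsNoetherianRing R] {n : ℕ} {Q Q' : Type u}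
    [AddCommGroup Q] [Module R Q] [AddCommGroup Q'] [Module R Q']
    (hQ' : ∀ M : ModuleCat.{u} R, ExtVanish R (n + 1) M Q')
    (h : ∀ (p : ℕ) (K : Submodule R (Fin p → R)),
      (∀ a : K →ₗ[R] Q', ∃ b : (Fin p → R) →ₗ[R] Q', b ∘ₗ K.subtype = a) →
      ∀ a : K →ₗ[R] Q, ∃ b : (Fin p → R) →ₗ[R] Q, b ∘ₗ K.subtype = a)
    (M : ModuleCat.{u} R) : ExtVanish R (n + 1) M Q := by
  have key (j : ℕ) : ∀ (M : Type u) [AddCommGroup M] [Module R M] [Module.Finite R M],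
      ExtVanish R (j + 1) M Q' → ExtVanish R (j + 1) M Q := by
    induction j with
    | zero =>
      intro M _ _ _ hM
      obtain ⟨p, f, hf⟩ := Module.Finite.exists_fin' R M
      exact .of_exists_extension _ f (Submodule.subtype_injective _) (exact_subtype_ker f) hf
        (h p _ (hM.exists_extension _ f (Submodule.subtype_injective _) (exact_subtype_ker f) hf))
    | succ j ih =>
      intro M _ _ _ hM
      obtain ⟨p, f, hf⟩ := Module.Finite.exists_fin' R M
      refine .right_of_left _ f (Submodule.subtype_injective _) (exact_subtype_ker f) hf
        (ih _ ?_) (.of_projective _)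
      exact .left_of_right _ f (Submodule.subtype_injective _) (exact_subtype_ker f) hf hM
        (.of_projective _)
  exact extVanish_of_baer (fun J => key n _ (hQ' (ModuleCat.of R (R ⧸ J)))) M

theorem extVanish_finsupp [IsNoetherianRing R] {n : ℕ}
    (hR : ∀ M : ModuleCat.{u} R, ExtVanish R (n + 1) M R) (I : Type u) (M : ModuleCat.{u} R) :
    ExtVanish R (n + 1) M (I →₀ R) := by
  classical
  refine extVanish_of_extension_transfer hR (fun p K hK a => ?_) M
  obtain ⟨s, hs⟩ := (inferInstance : Module.Finite R K).fg_top
  let S : Finset I := s.biUnion fun x => (a x).support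
  choose b hb using fun i : I => hK (Finsupp.lapply i ∘ₗ a)
  have hS : ⊤ ≤ (Finsupp.supported R R (S : Set I)).comap a := by
    rw [← hs, Submodule.span_le]
    intro x hx i hi
    exact Finset.mem_biUnion.mpr ⟨x, hx, hi⟩
  refine ⟨∑ i ∈ S, Finsupp.lsingle i ∘ₗ b i, LinearMap.ext fun x => Finsupp.ext fun i => ?_⟩
  have hbx : ∀ i, b i x = a x i := fun i => congr($(hb i) x)
  by_cases hi : i ∈ S
  · simp [Finsupp.finsetSum_apply, Finsupp.single_apply, hbx, hi]
  · have : a x i = 0 := by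
      by_contra h0
      exact hi (hS (x := x) trivial (Finsupp.mem_support_iff.mpr h0))
    simp [Finsupp.finsetSum_apply, Finsupp.single_apply, this, hi]

theorem extVanish_projective [IsNoetherianRing R] {n : ℕ}
    (hR : ∀ M : ModuleCat.{u} R, ExtVanish R (n + 1) M R) (M P : Type u) [AddCommGroup M]
    [Module R M] [AddCommGroup P] [Module R P] [Module.Projective R P] :
    ExtVanish R (n + 1) M P := by
  obtain ⟨s, hs⟩ := Module.projective_def'.mp (inferInstance : Module.Projective R P)
  exact .of_retract_right s (Finsupp.linearCombination R id) (fun a => congr($hs a))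
    (extVanish_finsupp hR P (ModuleCat.of R M))

theorem silp_le_of_injDim_le [IsNoetherianRing R] {n : ℕ} (h : injDim R R ≤ n) :
    silp R ≤ n := by
  rw [injDim_le_iff] at h
  refine iSup₂_le fun P hP => (injDim_le_iff _ _).mpr fun M => extVanish_projective h M P

end NoetherianTransfer

section CharacterDual

variable {R : Type u} [Ring R]

/-- The character group of `M`, as a left module through a ring homomorphism `R →+* Rᵐᵒᵖ`. -/
def CharDual (_ : R →+* Rᵐᵒᵖ) (M : Type u) [AddCommGroup M] : Type u := M →+ AddCircle (1 : ℚ)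

variable (φ ψ : R →+* Rᵐᵒᵖ) {M N P : Type u} [AddCommGroup M] [Module R M]
  [AddCommGroup N] [Module R N] [AddCommGroup P] [Module R P]

noncomputable instance : AddCommGroup (CharDual φ M) :=
  inferInstanceAs (AddCommGroup (M →+ AddCircle (1 : ℚ)))

instance : FunLike (CharDual φ M) M (AddCircle (1 : ℚ)) :=
  inferInstanceAs (FunLike (M →+ AddCircle (1 : ℚ)) M (AddCircle (1 : ℚ)))

instance : AddMonoidHomClass (CharDual φ M) M (AddCircle (1 : ℚ)) :=
  inferInstanceAs (AddMonoidHomClass (M →+ AddCircle (1 : ℚ)) M (AddCircle (1 : ℚ)))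

omit [Module R M] in
theorem CharDual.ext {χ χ' : CharDual φ M} (h : ∀ m, χ m = χ' m) : χ = χ' := DFunLike.ext _ _ h

omit [Module R M] in
theorem CharDual.add_apply (χ χ' : CharDual φ M) (m : M) : (χ + χ') m = χ m + χ' m := rfl

omit [Module R M] in
theorem CharDual.zero_apply (m : M) : (0 : CharDual φ M) m = 0 := rfl

noncomputable instance : Module R (CharDual φ M) where
  smul r χ := AddMonoidHom.comp χ (DistribSMul.toAddMonoidHom M (φ r).unop)
  one_smul χ := CharDual.ext φ fun m => congrArg χ (by simp)
  mul_smul r s χ := CharDual.ext φ fun m => congrArg χ (by simp [mul_smul])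
  smul_zero r := rfl
  smul_add r χ χ' := rfl
  add_smul r s χ := CharDual.ext φ fun m =>
    (congrArg χ (by simp [add_smul])).trans (map_add χ ((φ r).unop • m) ((φ s).unop • m))
  zero_smul χ := CharDual.ext φ fun m => (congrArg χ (by simp)).trans (map_zero χ)

theorem CharDual.smul_apply (r : R) (χ : CharDual φ M) (m : M) :
    (r • χ) m = χ ((φ r).unop • m) := rfl

omit [Module R M] in
theorem CharDual.sum_apply {ι : Type*} (s : Finset ι) (χ : ι → CharDual φ M) (m : M) :
    (∑ i ∈ s, χ i) m = ∑ i ∈ s, χ i m :=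
  map_sum (AddMonoidHom.eval (M := M) (N := AddCircle (1 : ℚ)) m) χ s

/-- Precomposition with a linear map. -/
noncomputable def CharDual.map (f : M →ₗ[R] N) : CharDual φ N →ₗ[R] CharDual φ M where
  toFun χ := AddMonoidHom.comp χ f.toAddMonoidHom
  map_add' _ _ := rfl
  map_smul' r χ := CharDual.ext φ fun m => congrArg χ (map_smul f (φ r).unop m).symm

theorem CharDual.map_surjective (f : M →ₗ[R] N) (hf : Function.Injective f) :
    Function.Surjective (CharDual.map φ f) := fun χ => by
  obtain ⟨χ', h⟩ := CharacterModule.dual_surjective_of_injective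
    f.toAddMonoidHom.toIntLinearMap hf χ
  exact ⟨χ', h⟩

theorem CharDual.map_injective (f : M →ₗ[R] N) (hf : Function.Surjective f) :
    Function.Injective (CharDual.map φ f) := fun χ χ' h => CharDual.ext φ fun n => by
  obtain ⟨m, rfl⟩ := hf n
  exact congr($h m)

theorem CharDual.map_exact (f : M →ₗ[R] N) (g : N →ₗ[R] P) (hfg : Function.Exact f g)
    (hg : Function.Surjective g) : Function.Exact (CharDual.map φ g) (CharDual.map φ f) := by
  intro χ
  constructor
  · intro h
    have hker : (LinearMap.ker g).toAddSubgroup ≤ AddMonoidHom.ker χ := by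
      intro x hx
      obtain ⟨m, rfl⟩ := (hfg x).mp hx
      exact congr($h m)
    refine ⟨g.toAddMonoidHom.liftOfSurjective hg ⟨χ, hker⟩, CharDual.ext φ fun n => ?_⟩
    exact g.toAddMonoidHom.liftOfRightInverse_comp_apply _ (Function.rightInverse_surjInv hg)
      ⟨χ, hker⟩ n
  · rintro ⟨χ, rfl⟩
    exact CharDual.ext φ fun m => (congrArg χ (hfg.apply_apply_eq_zero m)).trans (map_zero χ)

/-- The evaluation map into the double dual, for an adjoint pair of module maps. -/
noncomputable def CharDual.flip (hφψ : ∀ r, (φ (ψ r).unop).unop = r)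
    (f : M →ₗ[R] CharDual φ N) : N →ₗ[R] CharDual ψ M where
  toFun n := (AddMonoidHom.flip (P := AddCircle (1 : ℚ)) f.toAddMonoidHom) n
  map_add' _ _ := map_add _ _ _
  map_smul' r n := CharDual.ext ψ fun m => by
    change f m (r • n) = f ((ψ r).unop • m) n
    rw [LinearMap.map_smul, CharDual.smul_apply, hφψ]

theorem CharDual.injective (hφψ : ∀ r, (φ (ψ r).unop).unop = r)
    (hψφ : ∀ r, (ψ (φ r).unop).unop = r) [Module.Projective R P] :
    Module.Injective R (CharDual φ P) where
  out X Y _ _ _ _ f hf g := by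
    obtain ⟨h, hh⟩ := Module.projective_lifting_property (CharDual.map ψ f)
      (CharDual.flip φ ψ hφψ g) (CharDual.map_surjective ψ f hf)
    exact ⟨CharDual.flip ψ φ hψφ h, fun x => CharDual.ext φ fun p => congr($hh p x)⟩

theorem CharDual.extVanish (hφψ : ∀ r, (φ (ψ r).unop).unop = r)
    (hψφ : ∀ r, (ψ (φ r).unop).unop = r) {n : ℕ} (h : ProjDimLE R n M)
    (X : ModuleCat.{u} R) : ExtVanish R (n + 1) X (CharDual φ M) := by
  induction n generalizing M X with
  | zero =>
    have : Module.Projective R M := h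
    have := CharDual.injective φ ψ (P := M) hφψ hψφ
    exact .of_injective 0
  | succ n ih =>
    obtain h | ⟨P, f, hP, hf, h⟩ := h
    · have := CharDual.injective φ ψ (P := M) hφψ hψφ
      exact .of_injective _
    · have := CharDual.injective φ ψ (P := P) hφψ hψφ
      exact .sub_of_quotient (CharDual.map φ f) (CharDual.map φ (LinearMap.ker f).subtype)
        (CharDual.map_injective φ f hf) (CharDual.map_exact φ _ f (exact_subtype_ker f) hf)
        (CharDual.map_surjective φ _ (Submodule.subtype_injective _)) (ih h X) (.of_injective _)

/-- Extension problems into the ring are solvable if they are so into its double dual. -/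
theorem exists_extension_of_charDual [IsNoetherianRing R] (hφψ : ∀ r, (φ (ψ r).unop).unop = r)
    (p : ℕ) (K : Submodule R (Fin p → R))
    (hK : ∀ a : K →ₗ[R] CharDual ψ (CharDual φ R),
      ∃ b : (Fin p → R) →ₗ[R] CharDual ψ (CharDual φ R), b ∘ₗ K.subtype = a)
    (a : K →ₗ[R] R) : ∃ b : (Fin p → R) →ₗ[R] R, b ∘ₗ K.subtype = a := by
  classical
  obtain ⟨q, v, hv⟩ := Module.Finite.exists_fin (R := R) (M := K)
  let ι : R →ₗ[R] CharDual ψ (CharDual φ R) := CharDual.flip φ ψ hφψ LinearMap.id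
  obtain ⟨g, hg⟩ := hK (ι ∘ₗ a)
  let A : (Fin p → R) →+ (Fin q → R) :=
    { toFun := fun x i => ∑ j, (v i : Fin p → R) j * x j
      map_zero' := by ext i; simp
      map_add' := fun x y => by ext i; simp [mul_add, Finset.sum_add_distrib] }
  have hmem : (fun i => a (v i)) ∈ A.range := by
    by_contra hb
    obtain ⟨χ, hχ⟩ := CharacterModule.exists_character_apply_ne_zero_of_ne_zero
      (A := (Fin q → R) ⧸ A.range) (a := QuotientAddGroup.mk fun i => a (v i))
      (by rwa [Ne, QuotientAddGroup.eq_zero_iff])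
    let l : (Fin q → R) →+ AddCircle (1 : ℚ) :=
      AddMonoidHom.comp χ (QuotientAddGroup.mk' A.range)
    have hlA : ∀ x, l (A x) = 0 := fun x => by
      have : QuotientAddGroup.mk' A.range (A x) = 0 :=
        (QuotientAddGroup.eq_zero_iff _).mpr ⟨x, rfl⟩
      exact (congrArg χ this).trans (map_zero χ)
    let c : Fin q → CharDual φ R := fun i => l.comp (AddMonoidHom.single (fun _ => R) i)
    have hl : ∀ x : Fin q → R, l x = ∑ i, c i (x i) := fun x => by
      conv_lhs => rw [← Finset.univ_sum_single x, map_sum]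
      rfl
    have hz : ∀ j, ∑ i, (ψ ((v i : Fin p → R) j)).unop • c i = 0 := fun j =>
      CharDual.ext φ fun m => by
        rw [CharDual.sum_apply, CharDual.zero_apply, ← hlA (Pi.single j m), hl]
        refine Finset.sum_congr rfl fun i _ => ?_
        rw [CharDual.smul_apply, hφψ]
        congr 1
        simp [A, Pi.single_apply]
    apply hχ
    change l (fun i => a (v i)) = 0
    rw [hl]
    have h1 : ∀ i, c i (a (v i)) = ∑ j, g (Pi.single j 1)
        ((ψ ((v i : Fin p → R) j)).unop • c i) := fun i => by
      have h2 : c i (a (v i)) = g (v i) (c i) := congr($hg.symm (v i) (c i))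
      have h3 : (v i : Fin p → R) = ∑ j, (v i : Fin p → R) j • Pi.single j (1 : R) := by
        ext j; simp [Finset.sum_apply, Pi.single_apply]
      rw [h2]
      conv_lhs => rw [h3, map_sum, CharDual.sum_apply]
      refine Finset.sum_congr rfl fun j _ => ?_
      rw [map_smul, CharDual.smul_apply]
    simp_rw [h1]
    rw [Finset.sum_comm]
    refine Finset.sum_eq_zero fun j _ => ?_
    rw [← map_sum, hz, map_zero]
  obtain ⟨x, hx⟩ := hmem
  refine ⟨Fintype.linearCombination R x, ?_⟩
  refine LinearMap.ext_on_range hv fun i => ?_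
  have := congr_fun hx i
  simpa [A, Fintype.linearCombination_apply] using this

theorem injDim_le_of_spli_le [IsNoetherianRing R] (hφψ : ∀ r, (φ (ψ r).unop).unop = r)
    (hψφ : ∀ r, (ψ (φ r).unop).unop = r) {n : ℕ} (h : spli R ≤ n) : injDim R R ≤ n := by
  have hinj := CharDual.injective φ ψ (P := R) hφψ hψφ
  have hE : projDim R (CharDual φ R) ≤ n :=
    (le_iSup₂ (f := fun (M : ModuleCat.{u} R) (_ : Module.Injective R M) => projDim R M)
      (ModuleCat.of R (CharDual φ R)) hinj).trans h
  rw [projDim_le_iff, ← projDimLE_iff] at hE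
  rw [injDim_le_iff]
  exact extVanish_of_extension_transfer (CharDual.extVanish ψ φ hψφ hφψ hE)
    (exists_extension_of_charDual φ ψ hφψ)

end CharacterDual

section TwistedDual

variable {R : Type u} [Ring R]

theorem exists_factorization_of_surjective {P B Q : Type u} [AddCommGroup P] [Module R P]
    [AddCommGroup B] [Module R B] [AddCommGroup Q] [Module R Q] (g : P →ₗ[R] B)
    (hg : Function.Surjective g) (h : P →ₗ[R] Q) (hgh : ∀ x, g x = 0 → h x = 0) :
    ∃ b : B →ₗ[R] Q, ∀ x, b (g x) = h x :=
  ⟨(LinearMap.ker g).liftQ h hgh ∘ₗ (g.quotKerEquivOfSurjective hg).symm.toLinearMap, fun x => by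
    have : (g.quotKerEquivOfSurjective hg).symm (g x) = (LinearMap.ker g).mkQ x := by
      rw [LinearEquiv.symm_apply_eq]; rfl
    rw [LinearMap.comp_apply, LinearEquiv.coe_coe, this]; rfl⟩

/-- The dual `Hom_R(M, R)`, as a left module through a ring homomorphism `R →+* Rᵐᵒᵖ`. -/
def TwistedDual (_ : R →+* Rᵐᵒᵖ) (M : Type u) [AddCommGroup M] [Module R M] : Type u := M →ₗ[R] R

variable (φ ψ : R →+* Rᵐᵒᵖ) {M N P : Type u} [AddCommGroup M] [Module R M]
  [AddCommGroup N] [Module R N] [AddCommGroup P] [Module R P]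

noncomputable instance : AddCommGroup (TwistedDual φ M) :=
  inferInstanceAs (AddCommGroup (M →ₗ[R] R))

instance : FunLike (TwistedDual φ M) M R := inferInstanceAs (FunLike (M →ₗ[R] R) M R)

instance : LinearMapClass (TwistedDual φ M) R M R :=
  inferInstanceAs (LinearMapClass (M →ₗ[R] R) R M R)

noncomputable instance : Module R (TwistedDual φ M) := Module.compHom (M →ₗ[R] R) φ

theorem TwistedDual.ext {a b : TwistedDual φ M} (h : ∀ m, a m = b m) : a = b := DFunLike.ext _ _ h

theorem TwistedDual.smul_apply (r : R) (a : TwistedDual φ M) (m : M) :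
    (r • a) m = a m * (φ r).unop := rfl

theorem TwistedDual.add_apply (a b : TwistedDual φ M) (m : M) : (a + b) m = a m + b m := rfl

theorem TwistedDual.sum_apply {ι : Type*} (s : Finset ι) (a : ι → TwistedDual φ M) (m : M) :
    (∑ i ∈ s, a i) m = ∑ i ∈ s, a i m :=
  map_sum (⟨⟨fun a => a m, rfl⟩, fun _ _ => rfl⟩ : TwistedDual φ M →+ R) a s

/-- Precomposition with a linear map. -/
noncomputable def TwistedDual.map (f : M →ₗ[R] N) : TwistedDual φ N →ₗ[R] TwistedDual φ M where
  toFun a := LinearMap.comp a f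
  map_add' _ _ := rfl
  map_smul' _ _ := rfl

theorem TwistedDual.map_injective (f : M →ₗ[R] N) (hf : Function.Surjective f) :
    Function.Injective (TwistedDual.map φ f) := fun a b h => TwistedDual.ext φ fun n => by
  obtain ⟨m, rfl⟩ := hf n
  exact congr($h m)

theorem TwistedDual.map_exact (f : M →ₗ[R] N) (g : N →ₗ[R] P) (hfg : Function.Exact f g)
    (hg : Function.Surjective g) : Function.Exact (TwistedDual.map φ g) (TwistedDual.map φ f) := by
  intro a
  constructor
  · intro h
    obtain ⟨b, hb⟩ := exists_factorization_of_surjective g hg a fun x hx => by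
      obtain ⟨m, rfl⟩ := (hfg x).mp hx
      exact congr($h m)
    exact ⟨b, TwistedDual.ext φ hb⟩
  · rintro ⟨b, rfl⟩
    exact TwistedDual.ext φ fun m => (congrArg b (hfg.apply_apply_eq_zero m)).trans (map_zero b)

theorem TwistedDual.map_surjective (f : M →ₗ[R] N) (g : N →ₗ[R] P) (hf : Function.Injective f)
    (hfg : Function.Exact f g) (hg : Function.Surjective g) (h : ExtVanish R 1 P R) :
    Function.Surjective (TwistedDual.map φ f) :=
  h.exists_extension f g hf hfg hg

variable (hφψ : ∀ r, (φ (ψ r).unop).unop = r) (hψφ : ∀ r, (ψ (φ r).unop).unop = r)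

/-- The dual of a finite free module is finite free. -/
noncomputable def TwistedDual.piEquiv (p : ℕ) : TwistedDual φ (Fin p → R) ≃ₗ[R] (Fin p → R) where
  toFun a i := (ψ (a (Pi.single i 1))).unop
  map_add' a b := by ext i; simp [TwistedDual.add_apply]
  map_smul' r a := by ext i; simp [TwistedDual.smul_apply, hψφ]
  invFun x := Fintype.linearCombination R fun i => (φ (x i)).unop
  left_inv a := TwistedDual.ext φ fun m => by
    change Fintype.linearCombination R _ m = a m
    conv_rhs => rw [← Finset.univ_sum_single m, map_sum]
    rw [Fintype.linearCombination_apply]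
    refine Finset.sum_congr rfl fun i _ => ?_
    rw [hφψ, ← map_smul, ← Pi.single_smul, smul_eq_mul, mul_one]
  right_inv x := by
    ext i
    change (ψ (Fintype.linearCombination R _ (Pi.single i 1))).unop = x i
    rw [Fintype.linearCombination_apply_single, one_smul, hψφ]

/-- Evaluation at a vector, as a linear functional on the dual. -/
noncomputable def TwistedDual.eval (m : M) : TwistedDual φ M →ₗ[R] R where
  toFun a := (ψ (a m)).unop
  map_add' a b := by simp [TwistedDual.add_apply]
  map_smul' r a := by simp [TwistedDual.smul_apply, hψφ]

theorem TwistedDual.apply_eq_sum {p : ℕ} (a : TwistedDual φ (Fin p → R)) (m : Fin p → R) :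
    a m = ∑ i, m i * a (Pi.single i 1) := by
  conv_lhs => rw [← Finset.univ_sum_single m, map_sum]
  refine Finset.sum_congr rfl fun i _ => ?_
  rw [← smul_eq_mul (m i) (a _), ← map_smul, ← Pi.single_smul, smul_eq_mul, mul_one]

include hφψ hψφ in
theorem TwistedDual.exists_eval_eq {p : ℕ} (E : TwistedDual φ (Fin p → R) →ₗ[R] R) :
    ∃ q, ∀ a, E a = (ψ (a q)).unop := by
  let δ : Fin p → TwistedDual φ (Fin p → R) := fun j =>
    (LinearMap.proj j : (Fin p → R) →ₗ[R] R)
  refine ⟨fun j => (φ (E (δ j))).unop, fun a => ?_⟩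
  have ha : a = ∑ j, (ψ (a (Pi.single j 1))).unop • δ j := TwistedDual.ext φ fun m => by
    rw [TwistedDual.sum_apply, TwistedDual.apply_eq_sum]
    refine Finset.sum_congr rfl fun i _ => ?_
    rw [TwistedDual.smul_apply, hφψ]
    rfl
  rw [TwistedDual.apply_eq_sum, map_sum, Finset.unop_sum]
  conv_lhs => rw [ha, map_sum]
  refine Finset.sum_congr rfl fun i _ => ?_
  rw [map_smul, smul_eq_mul, map_mul, MulOpposite.unop_mul, hψφ]

section MaximalCohenMacaulay

variable (R) in
/-- Finitely generated modules with vanishing higher extension groups into the ring. -/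
def IsMaximalCohenMacaulay (K : Type u) [AddCommGroup K] [Module R K] : Prop :=
  Module.Finite R K ∧ ∀ i, ExtVanish R (i + 1) K R

theorem IsMaximalCohenMacaulay.ker [IsNoetherianRing R] {K : Type u} [AddCommGroup K] [Module R K]
    (hK : IsMaximalCohenMacaulay R K) {p : ℕ} (f : (Fin p → R) →ₗ[R] K)
    (hf : Function.Surjective f) : IsMaximalCohenMacaulay R (LinearMap.ker f) :=
  ⟨inferInstance, fun i => .left_of_right _ f (Submodule.subtype_injective _)
    (exact_subtype_ker f) hf (hK.2 (i + 1)) (.of_projective _)⟩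

variable [IsNoetherianRing R] {n : ℕ} (hR : ∀ M : ModuleCat.{u} R, ExtVanish R (n + 1) M R)
  {K : Type u} [AddCommGroup K] [Module R K]

include hR hφψ hψφ

theorem IsMaximalCohenMacaulay.extVanish_twistedDual (hK : IsMaximalCohenMacaulay R K) (i : ℕ) :
    ExtVanish R (i + 1) (TwistedDual φ K) R := by
  have key (j : ℕ) : ∀ (K : Type u) [AddCommGroup K] [Module R K], IsMaximalCohenMacaulay R K →
      ∀ i, n ≤ i + j → ExtVanish R (i + 1) (TwistedDual φ K) R := by
    induction j with
    | zero => exact fun K _ _ _ i hi => .mono_right (by lia) hR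
    | succ j ih =>
      intro K _ _ hK i hi
      have := hK.1
      obtain ⟨p, f, hf⟩ := Module.Finite.exists_fin' R K
      have : Module.Projective R (TwistedDual φ (Fin p → R)) :=
        .of_equiv (TwistedDual.piEquiv φ ψ hφψ hψφ p).symm
      exact .left_of_right (TwistedDual.map φ f) (TwistedDual.map φ (LinearMap.ker f).subtype)
        (TwistedDual.map_injective φ f hf)
        (TwistedDual.map_exact φ _ f (exact_subtype_ker f) hf)
        (TwistedDual.map_surjective φ _ f (Submodule.subtype_injective _) (exact_subtype_ker f) hf
          (hK.2 0))
        (ih _ (hK.ker f hf) (i + 1) (by lia)) (.of_projective _)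
  exact key n K hK i (by lia)

theorem IsMaximalCohenMacaulay.eq_zero_of_forall_dual (hK : IsMaximalCohenMacaulay R K) (x : K)
    (hx : ∀ a : TwistedDual φ K, a x = 0) : x = 0 := by
  have := hK.1
  obtain ⟨p, f, hf⟩ := Module.Finite.exists_fin' R K
  have hK1 := hK.ker f hf
  have := hK1.1
  obtain ⟨q, g, hg⟩ := Module.Finite.exists_fin' R (LinearMap.ker f)
  have hK2 := hK1.ker g hg
  obtain ⟨x, rfl⟩ := hf x
  obtain ⟨e, he⟩ := exists_factorization_of_surjective
    (TwistedDual.map φ (LinearMap.ker f).subtype)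
    (TwistedDual.map_surjective φ _ f (Submodule.subtype_injective _) (exact_subtype_ker f) hf
      (hK.2 0)) (TwistedDual.eval φ ψ hψφ x) fun a ha => by
      obtain ⟨b, rfl⟩ := (TwistedDual.map_exact φ _ f (exact_subtype_ker f) hf a).mp ha
      change (ψ (b (f x))).unop = 0
      rw [hx b, map_zero, MulOpposite.unop_zero]
  obtain ⟨E, hE⟩ := (hK2.extVanish_twistedDual φ ψ hφψ hψφ hR 0).exists_extension
    (TwistedDual.map φ g) (TwistedDual.map φ (LinearMap.ker g).subtype)
    (TwistedDual.map_injective φ g hg)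
    (TwistedDual.map_exact φ _ g (exact_subtype_ker g) hg)
    (TwistedDual.map_surjective φ _ g (Submodule.subtype_injective _) (exact_subtype_ker g) hg
      (hK1.2 0)) e
  obtain ⟨y, hy⟩ := TwistedDual.exists_eval_eq φ ψ hφψ hψφ E
  have key : ∀ a : TwistedDual φ (Fin p → R), a x = a (g y) := fun a => by
    have h1 : (ψ (a x)).unop = (ψ (a (g y))).unop := by
      have h2 := he a
      rw [← hE, LinearMap.comp_apply, hy] at h2
      exact h2.symm
    rw [← hφψ (a x), h1, hφψ]
  have hxy : x = g y := funext fun j =>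
    key (LinearMap.proj (R := R) (φ := fun _ : Fin p => R) j : (Fin p → R) →ₗ[R] R)
  rw [hxy]
  exact (g y).2

theorem IsMaximalCohenMacaulay.exists_cosyzygy (hK : IsMaximalCohenMacaulay R K) :
    ∃ (p : ℕ) (f : K →ₗ[R] (Fin p → R)), Function.Injective f ∧
      IsMaximalCohenMacaulay R ((Fin p → R) ⧸ LinearMap.range f) := by
  have := hK.1
  obtain ⟨q, g, hg⟩ := Module.Finite.exists_fin' R K
  have : IsNoetherian R (TwistedDual φ (Fin q → R)) :=
    isNoetherian_of_linearEquiv (TwistedDual.piEquiv φ ψ hφψ hψφ q).symm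
  have : Module.Finite R (TwistedDual φ K) :=
    .of_injective (TwistedDual.map φ g) (TwistedDual.map_injective φ g hg)
  obtain ⟨p, v, hv⟩ := Module.Finite.exists_fin (R := R) (M := TwistedDual φ K)
  let f : K →ₗ[R] (Fin p → R) := LinearMap.pi fun i => v i
  have hdual : ∀ a : TwistedDual φ K, ∃ c : Fin p → R, ∑ i, c i • v i = a := fun a =>
    (Submodule.mem_span_range_iff_exists_fun R).mp (by rw [hv]; trivial)
  have hf : Function.Injective f := by
    rw [injective_iff_map_eq_zero]
    refine fun x hx => hK.eq_zero_of_forall_dual φ ψ hφψ hψφ hR x fun a => ?_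
    obtain ⟨c, rfl⟩ := hdual a
    rw [TwistedDual.sum_apply]
    refine Finset.sum_eq_zero fun i _ => ?_
    have : v i x = 0 := congr_fun hx i
    rw [TwistedDual.smul_apply, this, zero_mul]
  refine ⟨p, f, hf, inferInstance, fun i => ?_⟩
  cases i with
  | zero =>
    refine .of_exists_extension f _ hf (exact_mkQ_range f) (Submodule.mkQ_surjective _) fun a => ?_
    obtain ⟨c, hc⟩ := hdual a
    refine ⟨Fintype.linearCombination R fun i => (φ (c i)).unop, LinearMap.ext fun x => ?_⟩
    have : (∑ i, c i • v i) x = a x := congr($hc x)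
    rw [← this, TwistedDual.sum_apply]
    rfl
  | succ i =>
    exact .right_of_left f _ hf (exact_mkQ_range f) (Submodule.mkQ_surjective _) (hK.2 i)
      (.of_projective _)

end MaximalCohenMacaulay

end TwistedDual

section GorensteinClasses

variable {R : Type u} [Ring R]

/-- There is a short exact sequence `0 → A → P → B → 0` with `P` projective. -/
def IsSyzygyOf (A B : ModuleCat.{u} R) : Prop :=
  ∃ (P : ModuleCat.{u} R) (f : A →ₗ[R] P) (g : P →ₗ[R] B), Module.Projective R P ∧
    Function.Injective f ∧ Function.Exact f g ∧ Function.Surjective g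

/-- A class of modules in which every module has a syzygy and a cosyzygy. -/
structure IsBiresolving (C : ModuleCat.{u} R → Prop) : Prop where
  exists_syzygy : ∀ X, C X → ∃ Y, C Y ∧ IsSyzygyOf Y X
  exists_cosyzygy : ∀ X, C X → ∃ Y, C Y ∧ IsSyzygyOf X Y

theorem isBiresolving_projective :
    IsBiresolving fun X : ModuleCat.{u} R => Module.Projective R X where
  exists_syzygy X hX := ⟨ModuleCat.of R PUnit.{u + 1},
    inferInstanceAs (Module.Projective R PUnit.{u + 1}), X, 0, LinearMap.id, hX, fun _ _ _ => rfl,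
    fun x => ⟨fun h => ⟨0, h.symm⟩, by rintro ⟨y, rfl⟩; rfl⟩, Function.surjective_id⟩
  exists_cosyzygy X hX := ⟨ModuleCat.of R PUnit.{u + 1},
    inferInstanceAs (Module.Projective R PUnit.{u + 1}), X, LinearMap.id, 0, hX,
    Function.injective_id, fun x => ⟨fun _ => ⟨x, rfl⟩, fun _ => rfl⟩,
    fun _ => ⟨0, rfl⟩⟩

theorem exists_int_chain {S : Type*} {r : S → S → Prop} (h1 : ∀ x, ∃ y, r y x)
    (h2 : ∀ x, ∃ y, r x y) (x : S) : ∃ V : ℤ → S, V 2 = x ∧ ∀ i, r (V (i + 1)) (V i) := by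
  choose s hs using h1
  choose t ht using h2
  let W : ℤ → S := fun i => match i with
    | .ofNat n => s^[n] x
    | .negSucc n => t^[n + 1] x
  have hW : ∀ i, r (W (i + 1)) (W i) := fun i => match i with
    | .ofNat n => by
      change r (s^[n + 1] x) (s^[n] x)
      rw [Function.iterate_succ_apply']
      exact hs _
    | .negSucc 0 => ht x
    | .negSucc (n + 1) => by
      change r (t^[n + 1] x) (t^[n + 1 + 1] x)
      rw [Function.iterate_succ_apply' _ (n + 1)]
      exact ht _
  refine ⟨fun i => W (i - 2), rfl, fun i => ?_⟩
  have := hW (i - 2)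
  rwa [show i - 2 + 1 = i + 1 - 2 by ring] at this

theorem IsGorensteinProjective.of_equiv {M N : Type u} [AddCommGroup M] [Module R M]
    [AddCommGroup N] [Module R N] (e : M ≃ₗ[R] N) (h : IsGorensteinProjective R M) :
    IsGorensteinProjective R N := by
  obtain ⟨P, d, h1, h2, h3, ⟨e'⟩⟩ := h
  exact ⟨P, d, h1, h2, h3, ⟨e.symm.trans e'⟩⟩

theorem IsBiresolving.isGorensteinProjective {C : ModuleCat.{u} R → Prop} (hC : IsBiresolving C)
    (hExt : ∀ X, C X → ∀ Q : ModuleCat.{u} R, Module.Projective R Q → ExtVanish R 1 X Q)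
    (X : ModuleCat.{u} R) (hX : C X) : IsGorensteinProjective R X := by
  obtain ⟨V, hV2, hV⟩ := exists_int_chain (S := {X // C X}) (r := fun A B => IsSyzygyOf A.1 B.1)
    (fun X => (hC.exists_syzygy X X.2).elim fun Y hY => ⟨⟨Y, hY.1⟩, hY.2⟩)
    (fun X => (hC.exists_cosyzygy X X.2).elim fun Y hY => ⟨⟨Y, hY.1⟩, hY.2⟩) ⟨X, hX⟩
  choose P f g hP hf hfg hg using hV
  have hker : ∀ i, LinearMap.ker (f i ∘ₗ g (i + 1)) = LinearMap.range (f (i + 1)) := fun i => by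
    rw [LinearMap.ker_comp_of_ker_eq_bot _ (LinearMap.ker_eq_bot.mpr (hf i)),
      (LinearMap.exact_iff.mp (hfg (i + 1)))]
  refine ⟨P, fun i => f i ∘ₗ g (i + 1), hP, fun i => ?_, fun Q hQ i a ha => ?_, ?_⟩
  · rw [hker, LinearMap.range_comp_of_range_eq_top _ (LinearMap.range_eq_top.mpr (hg _))]
  · obtain ⟨b, hb⟩ := exists_factorization_of_surjective (g (i + 1)) (hg _) a fun x hx => by
      obtain ⟨y, rfl⟩ := (hfg _ x).mp hx
      obtain ⟨z, rfl⟩ := hg _ y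
      exact congr($ha z)
    obtain ⟨c, hc⟩ := (hExt _ (V i).2 Q hQ).exists_extension (f i) (g i) (hf i) (hfg i) (hg i) b
    refine ⟨c, LinearMap.ext fun x => ?_⟩
    rw [← hb x, ← hc]
    rfl
  · have h2 : V (0 + 1 + 1) = ⟨X, hX⟩ := hV2
    have e : X ≃ₗ[R] (V (0 + 1 + 1)).1 := by rw [h2]
    exact ⟨e.trans ((LinearEquiv.ofInjective _ (hf (0 + 1))).trans
      (LinearEquiv.ofEq _ _ (hker 0).symm))⟩

theorem isGorensteinProjective_of_projective (P : Type u) [AddCommGroup P] [Module R P]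
    [h : Module.Projective R P] : IsGorensteinProjective R P :=
  isBiresolving_projective.isGorensteinProjective (fun X (_ : Module.Projective R X) _ _ =>
    .of_projective 0) (ModuleCat.of R P) h

theorem GProjDimLE.of_equiv {n : ℕ} {M N : Type u} [AddCommGroup M] [Module R M]
    [AddCommGroup N] [Module R N] (e : M ≃ₗ[R] N) (h : GProjDimLE R n M) : GProjDimLE R n N := by
  cases n with
  | zero => exact IsGorensteinProjective.of_equiv e h
  | succ n =>
    obtain h | ⟨G, f, hG, hf, h⟩ := h
    · exact .inl (.of_equiv e h)
    · refine .inr ⟨G, e.toLinearMap ∘ₗ f, hG, e.surjective.comp hf, ?_⟩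
      rwa [LinearMap.ker_comp_of_ker_eq_bot _ (LinearMap.ker_eq_bot.mpr e.injective)]

/-- `X` has a projective resolution of length `n` ending in a module of the class `C`. -/
def HasResolution (C : ModuleCat.{u} R → Prop) : ℕ → ModuleCat.{u} R → Prop
  | 0, X => C X
  | n + 1, X => ∃ K, HasResolution C n K ∧ IsSyzygyOf K X

variable {C : ModuleCat.{u} R → Prop}

theorem HasResolution.gProjDimLE (hG : ∀ X, C X → IsGorensteinProjective R X) {n : ℕ}
    {X : ModuleCat.{u} R} (h : HasResolution C n X) : GProjDimLE R n X := by
  induction n generalizing X with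
  | zero => exact hG X h
  | succ n ih =>
    obtain ⟨K, hK, P, f, g, hP, hf, hfg, hg⟩ := h
    refine .inr ⟨P, g, isGorensteinProjective_of_projective P, hg, .of_equiv ?_ (ih hK)⟩
    exact (LinearEquiv.ofInjective f hf).trans
      (LinearEquiv.ofEq _ _ (LinearMap.exact_iff.mp hfg).symm)

theorem IsBiresolving.extVanish (hC : IsBiresolving C) {n : ℕ} {Q : Type u} [AddCommGroup Q]
    [Module R Q] (hQ : ∀ M : ModuleCat.{u} R, ExtVanish R (n + 1) M Q) {X : ModuleCat.{u} R}
    (hX : C X) (i : ℕ) : ExtVanish R (i + 1) X Q := by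
  have key (j : ℕ) : ∀ X, C X → ∀ i, n ≤ i + j → ExtVanish R (i + 1) X Q := by
    induction j with
    | zero => exact fun X _ i hi => .mono_right (by lia) hQ
    | succ j ih =>
      intro X hX i hi
      obtain ⟨Y, hY, P, f, g, hP, hf, hfg, hg⟩ := hC.exists_cosyzygy X hX
      exact .left_of_right f g hf hfg hg (ih Y hY (i + 1) (by lia)) (.of_projective _)
  exact key n X hX i (by lia)

/-- A module with a resolution of length `n` ending in a biresolving class embeds into a module of
projective dimension at most `n` with cokernel in the class. -/
theorem HasResolution.exists_embedding (hC : IsBiresolving C)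
    (hExt : ∀ X, C X → ∀ Q : ModuleCat.{u} R, Module.Projective R Q → ExtVanish R 1 X Q) {n : ℕ}
    {X : ModuleCat.{u} R} (h : HasResolution C n X) :
    ∃ (L G : ModuleCat.{u} R) (f : X →ₗ[R] L) (g : L →ₗ[R] G), Function.Injective f ∧
      Function.Exact f g ∧ Function.Surjective g ∧ C G ∧
      ∀ N : ModuleCat.{u} R, ExtVanish R (n + 1) L N := by
  induction n generalizing X with
  | zero =>
    obtain ⟨Y, hY, P, f, g, hP, hf, hfg, hg⟩ := hC.exists_cosyzygy X h
    exact ⟨P, Y, f, g, hf, hfg, hg, hY, fun N => .of_projective 0⟩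
  | succ n ih =>
    obtain ⟨K, hK, P, f, g, hP, hf, hfg, hg⟩ := h
    obtain ⟨L, G, j, p, hj, hjp, hp, hG, hL⟩ := ih hK
    obtain ⟨G', hG', Q, b, c, hQ, hb, hbc, hc⟩ := hC.exists_cosyzygy G hG
    obtain ⟨a, ha⟩ := (hExt G hG P hP).exists_extension j p hj hjp hp f
    have ha' : ∀ x, a (j x) = f x := fun x => congr($ha x)
    let m : L →ₗ[R] P × Q := a.prod (b ∘ₗ p)
    have hm : Function.Injective m := by
      rw [injective_iff_map_eq_zero]
      intro x hx
      have hx1 : a x = 0 := congr(($hx).1)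
      have hx2 : b (p x) = 0 := congr(($hx).2)
      obtain ⟨y, rfl⟩ := (hjp x).mp (hb (hx2.trans (map_zero b).symm))
      rw [ha'] at hx1
      rw [hf (hx1.trans (map_zero f).symm), map_zero]
    obtain ⟨u, hu⟩ := exists_factorization_of_surjective g hg
      ((LinearMap.range m).mkQ ∘ₗ LinearMap.inl R P Q) fun x hx => by
        obtain ⟨y, rfl⟩ := (hfg x).mp hx
        refine (Submodule.Quotient.mk_eq_zero _).mpr ⟨j y, Prod.ext (ha' y) ?_⟩
        change b (p (j y)) = 0
        rw [hjp.apply_apply_eq_zero, map_zero]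
    let v : ((P × Q) ⧸ LinearMap.range m) →ₗ[R] G' :=
      (LinearMap.range m).liftQ (c ∘ₗ LinearMap.snd R P Q) (by
        rintro _ ⟨x, rfl⟩
        exact hbc.apply_apply_eq_zero (p x))
    have hv : ∀ y, v ((LinearMap.range m).mkQ y) = c y.2 := fun _ => rfl
    refine ⟨ModuleCat.of R ((P × Q) ⧸ LinearMap.range m), G', u, v, ?_, ?_, ?_, hG', fun N => ?_⟩
    · rw [injective_iff_map_eq_zero]
      intro x hx
      obtain ⟨x, rfl⟩ := hg x
      rw [hu] at hx
      obtain ⟨y, hy⟩ := (Submodule.Quotient.mk_eq_zero _).mp hx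
      have hy1 : a y = x := congr(($hy).1)
      have hy2 : b (p y) = 0 := congr(($hy).2)
      obtain ⟨z, rfl⟩ := (hjp y).mp (hb (hy2.trans (map_zero b).symm))
      rw [← hy1, ha']
      exact hfg.apply_apply_eq_zero z
    · intro y
      constructor
      · obtain ⟨⟨s, t⟩, rfl⟩ := Submodule.mkQ_surjective _ y
        intro hy
        rw [hv] at hy
        obtain ⟨w, hw⟩ := (hbc t).mp hy
        obtain ⟨w, rfl⟩ := hp w
        refine ⟨g (s - a w), ?_⟩
        rw [hu, ← sub_eq_zero, LinearMap.comp_apply, ← map_sub]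
        refine (Submodule.Quotient.mk_eq_zero _).mpr ⟨-w, ?_⟩
        ext <;> simp [m, hw]
      · rintro ⟨x, rfl⟩
        obtain ⟨x, rfl⟩ := hg x
        rw [hu, LinearMap.comp_apply, hv]
        exact map_zero c
    · intro y
      obtain ⟨t, rfl⟩ := hc y
      exact ⟨(LinearMap.range m).mkQ (0, t), rfl⟩
    · exact .right_of_left m (LinearMap.range m).mkQ hm (exact_mkQ_range m)
        (Submodule.mkQ_surjective _) (hL N) (.of_projective _)

theorem lGgldim_le_of_hasResolution (hG : ∀ X, C X → IsGorensteinProjective R X) {n : ℕ}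
    (h : ∀ X, HasResolution C n X) : lGgldim R ≤ n :=
  iSup_le fun X => sInf_le ⟨n, rfl, (h X).gProjDimLE hG⟩

theorem spli_le_of_hasResolution (hC : IsBiresolving C)
    (hExt : ∀ X, C X → ∀ Q : ModuleCat.{u} R, Module.Projective R Q → ExtVanish R 1 X Q) {n : ℕ}
    (h : ∀ X, HasResolution C n X) : spli R ≤ n := by
  refine iSup₂_le fun I hI => (projDim_le_iff _ _).mpr fun N => ?_
  obtain ⟨L, G, f, g, hf, -, -, -, hL⟩ := (h I).exists_embedding hC hExt
  obtain ⟨r, hr⟩ := hI.out f hf LinearMap.id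
  exact .of_retract_left f r hr (hL N)

end GorensteinClasses

section DiagonalTensor

open Coalgebra

variable {k : Type u} [Field k] {H : Type u} [Ring H] [HopfAlgebra k H]
variable {A B D : Type u} [AddCommGroup A] [Module k A] [Module H A] [IsScalarTower k H A]
  [SMulCommClass k H A] [AddCommGroup B] [Module k B] [Module H B] [IsScalarTower k H B]
  [SMulCommClass k H B] [AddCommGroup D] [Module k D] [Module H D] [IsScalarTower k H D]
  [SMulCommClass k H D]
variable (M : Type u) [AddCommGroup M] [Module k M] [Module H M] [IsScalarTower k H M]
  [SMulCommClass k H M]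

/-- A pure tensor, as an element of the diagonal tensor product. -/
noncomputable def diag {M : Type u} [AddCommGroup M] [Module k M] [Module H M]
    [IsScalarTower k H M] [SMulCommClass k H M] (z : A ⊗[k] M) : tensorMod k H A M := z

variable (k H) in
/-- The action of `H ⊗ H` on `A ⊗ M`. -/
noncomputable def tensorAct (A M : Type u) [AddCommGroup A] [Module k A] [Module H A]
    [IsScalarTower k H A] [SMulCommClass k H A] [AddCommGroup M] [Module k M] [Module H M]
    [IsScalarTower k H M] [SMulCommClass k H M] : H ⊗[k] H →ₐ[k] Module.End k (A ⊗[k] M) :=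
  (Module.endTensorEndAlgHom (R := k) (S := k) (A := k) (M := A) (N := M)).comp
    (Algebra.TensorProduct.map (hRep k H A) (hRep k H M))

theorem tensorAct_tmul (x y : H) (a : A) (m : M) :
    tensorAct k H A M (x ⊗ₜ y) (a ⊗ₜ m) = (x • a) ⊗ₜ (y • m) := rfl

theorem rTensor_tensorAct (f : A →ₗ[H] B) (t : H ⊗[k] H) (z : A ⊗[k] M) :
    LinearMap.rTensor M (f.restrictScalars k) (tensorAct k H A M t z) =
      tensorAct k H B M t (LinearMap.rTensor M (f.restrictScalars k) z) := by
  induction t with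
  | zero => simp
  | add t t' h1 h2 => simp [h1, h2]
  | tmul x y =>
    induction z with
    | zero => simp
    | add z z' h1 h2 => simp only [map_add, h1, h2]
    | tmul a m => simp [tensorAct_tmul]

/-- The diagonal tensor product is functorial in its first argument. -/
noncomputable def diagMap (f : A →ₗ[H] B) : tensorMod k H A M →ₗ[H] tensorMod k H B M where
  toFun := LinearMap.rTensor M (f.restrictScalars k)
  map_add' := map_add (LinearMap.rTensor M (f.restrictScalars k))
  map_smul' h z := rTensor_tensorAct M f (comul h) z

theorem diagMap_injective (f : A →ₗ[H] B) (hf : Function.Injective f) :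
    Function.Injective (diagMap (k := k) M f) :=
  Module.Flat.rTensor_preserves_injective_linearMap (M := M) (f.restrictScalars k) hf

theorem diagMap_surjective (f : A →ₗ[H] B) (hf : Function.Surjective f) :
    Function.Surjective (diagMap (k := k) M f) :=
  LinearMap.rTensor_surjective M (g := f.restrictScalars k) hf

theorem diagMap_exact (f : A →ₗ[H] B) (g : B →ₗ[H] D) (hfg : Function.Exact f g)
    (hg : Function.Surjective g) : Function.Exact (diagMap (k := k) M f) (diagMap (k := k) M g) :=
  rTensor_exact M (f := f.restrictScalars k) (g := g.restrictScalars k) hfg hg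

/-- The linear map `h ⊗ m ↦ ∑ h₁ ⊗ h₂ m`. -/
noncomputable def untwist : H ⊗[k] M →ₗ[k] H ⊗[k] M :=
  TensorProduct.lift
    { toFun h := tensorAct k H H M (comul h) ∘ₗ TensorProduct.mk k H M 1
      map_add' := by intros; ext; simp
      map_smul' := by intros; ext; simp }

/-- The linear map `h ⊗ m ↦ ∑ h₁ ⊗ S(h₂) m`. -/
noncomputable def twist : H ⊗[k] M →ₗ[k] H ⊗[k] M :=
  TensorProduct.lift
    { toFun h := tensorAct k H H M
        (LinearMap.lTensor H (HopfAlgebra.antipode k) (comul h)) ∘ₗ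
          TensorProduct.mk k H M 1
      map_add' := by intros; ext; simp
      map_smul' := by intros; ext; simp }

theorem untwist_tmul (h : H) (m : M) :
    untwist M (h ⊗ₜ[k] m) = tensorAct k H H M (comul h) (1 ⊗ₜ m) := rfl

theorem untwist_tmul_eq_sum {ι : Type*} {h : H} (r : Coalgebra.Repr k h ι) (m : M) :
    untwist M (h ⊗ₜ[k] m) = ∑ i ∈ r.index, r.left i ⊗ₜ (r.right i • m) := by
  rw [untwist_tmul, ← r.eq, map_sum, LinearMap.sum_apply]
  simp [tensorAct_tmul]

theorem twist_tmul_eq_sum {ι : Type*} {h : H} (r : Coalgebra.Repr k h ι) (m : M) :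
    twist M (h ⊗ₜ[k] m) =
      ∑ i ∈ r.index, r.left i ⊗ₜ (HopfAlgebra.antipode k (r.right i) • m) := by
  change tensorAct k H H M (LinearMap.lTensor H (HopfAlgebra.antipode k) (comul h)) (1 ⊗ₜ m) = _
  rw [← r.eq, map_sum, map_sum, LinearMap.sum_apply]
  simp [tensorAct_tmul]

omit [Module H M] [IsScalarTower k H M] [SMulCommClass k H M] in
theorem sum_tmul_map_eq {ι κ : Type*} {h : H} (r : Coalgebra.Repr k h ι)
    (r' : (i : ι) → Coalgebra.Repr k (r.left i) κ) (m : M) (T : H ⊗[k] H →ₗ[k] M)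
    (hT : ∀ y, T (comul y) = counit (R := k) y • m) :
    ∑ i ∈ r.index, ∑ j ∈ (r' i).index,
      (r' i).left j ⊗ₜ[k] T ((r' i).right j ⊗ₜ r.right i) = h ⊗ₜ[k] m := by
  have h1 := congrArg (LinearMap.lTensor H T)
    (sum_tmul_tmul_eq r r' fun i => ℛ k (r.right i))
  simp only [map_sum, LinearMap.lTensor_tmul] at h1
  rw [h1]
  have h2 : ∀ i, ∑ j ∈ (ℛ k (r.right i)).index, r.left i ⊗ₜ[k]
      T ((ℛ k (r.right i)).left j ⊗ₜ (ℛ k (r.right i)).right j) =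
      LinearMap.lTensor H (LinearMap.toSpanSingleton k M m)
        (r.left i ⊗ₜ counit (R := k) (r.right i)) := fun i => by
    rw [← tmul_sum, ← map_sum, (ℛ k (r.right i)).eq, hT]
    simp
  rw [Finset.sum_congr rfl fun i _ => h2 i, ← map_sum, sum_tmul_counit_eq]
  simp

theorem untwist_twist (z : H ⊗[k] M) : untwist M (twist M z) = z := by
  induction z with
  | zero => simp
  | add z z' h1 h2 => simp [h1, h2]
  | tmul h m =>
    rw [twist_tmul_eq_sum M (ℛ k h), map_sum, ← sum_tmul_map_eq M (ℛ k h)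
      (fun i => ℛ k ((ℛ k h).left i)) m ((LinearMap.toSpanSingleton H M m).restrictScalars k ∘ₗ
        LinearMap.mul' k H ∘ₗ LinearMap.lTensor H (HopfAlgebra.antipode k)) fun y => ?_]
    · refine Finset.sum_congr rfl fun i _ => ?_
      rw [untwist_tmul_eq_sum M (ℛ k ((ℛ k h).left i))]
      simp [mul_smul]
    · simp

theorem twist_untwist (z : H ⊗[k] M) : twist M (untwist M z) = z := by
  induction z with
  | zero => simp
  | add z z' h1 h2 => simp [h1, h2]
  | tmul h m =>
    rw [untwist_tmul_eq_sum M (ℛ k h), map_sum, ← sum_tmul_map_eq M (ℛ k h)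
      (fun i => ℛ k ((ℛ k h).left i)) m ((LinearMap.toSpanSingleton H M m).restrictScalars k ∘ₗ
        LinearMap.mul' k H ∘ₗ LinearMap.rTensor H (HopfAlgebra.antipode k)) fun y => ?_]
    · refine Finset.sum_congr rfl fun i _ => ?_
      rw [twist_tmul_eq_sum M (ℛ k ((ℛ k h).left i))]
      simp [mul_smul]
    · simp

/-- The diagonal tensor product of `H` with `M` is isomorphic to the free module on `M`. -/
noncomputable def untwistEquiv : H ⊗[k] M ≃ₗ[H] tensorMod k H H M where
  toFun z := diag (untwist M z)
  map_add' := map_add (untwist M)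
  map_smul' h z := by
    change untwist M (h • z) = tensorAct k H H M (comul h) (untwist M z)
    induction z with
    | zero => simp
    | add z z' h1 h2 => simp only [smul_add, map_add, h1, h2]
    | tmul x m => simp [smul_tmul', untwist_tmul]
  invFun := twist M
  left_inv := twist_untwist M
  right_inv := untwist_twist M

theorem projective_tensorMod_self : Module.Projective H (tensorMod k H H M) :=
  .of_equiv (untwistEquiv M)

theorem projective_tensorMod_pi (p : ℕ) : Module.Projective H (tensorMod k H (Fin p → H) M) := by
  have := projective_tensorMod_self (k := k) (H := H) M
  have : Module.Projective H (Fin p → tensorMod k H H M) :=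
    .of_equiv (DFinsupp.linearEquivFunOnFintype (R := H) (M := fun _ : Fin p => tensorMod k H H M))
  refine .of_split
    (LinearMap.pi fun i => diagMap (k := k) M (LinearMap.proj (R := H) (φ := fun _ : Fin p => H) i))
    (∑ i, diagMap (k := k) M (LinearMap.single H (fun _ : Fin p => H) i) ∘ₗ LinearMap.proj i)
    (LinearMap.ext fun z => ?_)
  have key (z : (Fin p → H) ⊗[k] M) : ∑ i, LinearMap.rTensor M
      ((LinearMap.single H (fun _ : Fin p => H) i).restrictScalars k)
      (LinearMap.rTensor M ((LinearMap.proj (R := H) (φ := fun _ : Fin p => H) i).restrictScalars k)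
        z) = z := by
    induction z with
    | zero => simp
    | add z z' h1 h2 => simp only [map_add, Finset.sum_add_distrib, h1, h2]
    | tmul x m =>
      simp only [LinearMap.rTensor_tmul, ← sum_tmul]
      congr 1
      exact Finset.univ_sum_single x
  rw [LinearMap.comp_apply, LinearMap.sum_apply]
  exact key z

/-- Tensoring with the trivial module is the identity. -/
noncomputable def trivTensorEquiv [Module H k] [IsScalarTower k H k] [SMulCommClass k H k]
    (htriv : ∀ (h : H) (c : k), h • c = counit (R := k) h * c) : tensorMod k H k M ≃ₗ[H] M where
  toFun := TensorProduct.lid k M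
  map_add' := map_add (TensorProduct.lid k M)
  map_smul' h z := by
    change TensorProduct.lid k M (tensorAct k H k M (comul h) z) = h • TensorProduct.lid k M z
    change k ⊗[k] M at z
    induction z with
    | zero => simp
    | add z z' h1 h2 => simp only [map_add, smul_add, h1, h2]
    | tmul c m =>
      conv_lhs => rw [← (ℛ k h).eq]
      conv_rhs => rw [← sum_counit_smul (ℛ k h)]
      rw [map_sum, LinearMap.sum_apply, map_sum, Finset.sum_smul]
      refine Finset.sum_congr rfl fun i _ => ?_
      rw [tensorAct_tmul, TensorProduct.lid_tmul, TensorProduct.lid_tmul, htriv, smul_assoc,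
        smul_comm _ c m, mul_smul]
  invFun := (TensorProduct.lid k M).symm
  left_inv := (TensorProduct.lid k M).left_inv
  right_inv := (TensorProduct.lid k M).right_inv

end DiagonalTensor

section TensorClass

variable {R : Type u} [Ring R]

theorem IsSyzygyOf.congr_right {A B B' : ModuleCat.{u} R} (h : IsSyzygyOf A B) (e : B ≃ₗ[R] B') :
    IsSyzygyOf A B' := by
  obtain ⟨P, f, g, hP, hf, hfg, hg⟩ := h
  exact ⟨P, f, e.toLinearMap ∘ₗ g, hP, hf,
    (LinearEquiv.postcomp_exact_iff_exact (e := e)).mpr hfg, e.surjective.comp hg⟩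

theorem IsSyzygyOf.congr_left {A A' B : ModuleCat.{u} R} (h : IsSyzygyOf A B) (e : A' ≃ₗ[R] A) :
    IsSyzygyOf A' B := by
  obtain ⟨P, f, g, hP, hf, hfg, hg⟩ := h
  exact ⟨P, f ∘ₗ e.toLinearMap, g, hP, hf.comp e.injective,
    (LinearEquiv.precomp_exact_iff_exact (e := e)).mpr hfg, hg⟩

theorem HasResolution.congr {C : ModuleCat.{u} R → Prop}
    (hC : ∀ X Y : ModuleCat.{u} R, C X → (X ≃ₗ[R] Y) → C Y) {n : ℕ} {X Y : ModuleCat.{u} R}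
    (h : HasResolution C n X) (e : X ≃ₗ[R] Y) : HasResolution C n Y := by
  cases n with
  | zero => exact hC _ _ h e
  | succ n =>
    obtain ⟨K, hK, hX⟩ := h
    exact ⟨K, hK, hX.congr_right e⟩

variable (k : Type u) [Field k] (H : Type u) [Ring H] [HopfAlgebra k H]

/-- The modules isomorphic to a diagonal tensor product `K ⊗ M` with `K` maximal
Cohen-Macaulay. -/
def tensorClass (X : ModuleCat.{u} H) : Prop :=
  ∃ (K M : Type u) (_ : AddCommGroup K) (_ : Module k K) (_ : Module H K) (_ : IsScalarTower k H K)
    (_ : SMulCommClass k H K) (_ : AddCommGroup M) (_ : Module k M) (_ : Module H M)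
    (_ : IsScalarTower k H M) (_ : SMulCommClass k H M),
    IsMaximalCohenMacaulay H K ∧ Nonempty (tensorMod k H K M ≃ₗ[H] X)

variable {k H}
variable {K : Type u} [AddCommGroup K] [Module k K] [Module H K] [IsScalarTower k H K]
  [SMulCommClass k H K]
variable (M : Type u) [AddCommGroup M] [Module k M] [Module H M] [IsScalarTower k H M]
  [SMulCommClass k H M]

theorem isSyzygyOf_tensorMod_ker {p : ℕ} (f : (Fin p → H) →ₗ[H] K) (hf : Function.Surjective f) :
    IsSyzygyOf (tensorMod k H (LinearMap.ker f) M) (tensorMod k H K M) :=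
  ⟨tensorMod k H (Fin p → H) M, diagMap (k := k) M (LinearMap.ker f).subtype, diagMap (k := k) M f,
    projective_tensorMod_pi M p, diagMap_injective M _ (Submodule.injective_subtype _),
    diagMap_exact M _ _ (exact_subtype_ker f) hf, diagMap_surjective M _ hf⟩

theorem isSyzygyOf_tensorMod_quotient {p : ℕ} (f : K →ₗ[H] (Fin p → H))
    (hf : Function.Injective f) :
    IsSyzygyOf (tensorMod k H K M) (tensorMod k H ((Fin p → H) ⧸ LinearMap.range f) M) :=
  ⟨tensorMod k H (Fin p → H) M, diagMap (k := k) M f, diagMap (k := k) M (LinearMap.range f).mkQ,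
    projective_tensorMod_pi M p, diagMap_injective M _ hf,
    diagMap_exact M _ _ (exact_mkQ_range f) (Submodule.mkQ_surjective _),
    diagMap_surjective M _ (Submodule.mkQ_surjective _)⟩

theorem tensorClass_tensorMod (hK : IsMaximalCohenMacaulay H K) :
    tensorClass k H (tensorMod k H K M) :=
  ⟨K, M, _, _, _, ‹_›, ‹_›, _, _, _, ‹_›, ‹_›, hK, ⟨.refl _ _⟩⟩

theorem tensorClass.congr {X Y : ModuleCat.{u} H} (hX : tensorClass k H X) (e : X ≃ₗ[H] Y) :
    tensorClass k H Y := by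
  obtain ⟨K, M, _, _, _, _, _, _, _, _, _, _, hK, ⟨e'⟩⟩ := hX
  exact ⟨K, M, _, _, _, ‹_›, ‹_›, _, _, _, ‹_›, ‹_›, hK, ⟨e'.trans e⟩⟩

theorem hasResolution_tensorMod [IsNoetherianRing H] (j : ℕ) {K : Type u} [AddCommGroup K]
    [Module k K] [Module H K] [IsScalarTower k H K] [SMulCommClass k H K] [Module.Finite H K]
    (hK : ∀ i, j ≤ i → ExtVanish H (i + 1) K H) :
    HasResolution (tensorClass k H) j (tensorMod k H K M) := by
  induction j generalizing K with
  | zero => exact tensorClass_tensorMod M ⟨‹_›, fun i => hK i (Nat.zero_le i)⟩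
  | succ j ih =>
    obtain ⟨p, f, hf⟩ := Module.Finite.exists_fin' H K
    refine ⟨_, ih fun i hi => ?_, isSyzygyOf_tensorMod_ker M f hf⟩
    exact ExtVanish.left_of_right _ f (Submodule.injective_subtype _) (exact_subtype_ker f) hf
      (hK (i + 1) (Nat.succ_le_succ hi)) (.of_projective i)

theorem isBiresolving_tensorClass [IsNoetherianRing H] (φ ψ : H →+* Hᵐᵒᵖ)
    (hφψ : ∀ r, (φ (ψ r).unop).unop = r) (hψφ : ∀ r, (ψ (φ r).unop).unop = r) {n : ℕ}
    (hH : ∀ M : ModuleCat.{u} H, ExtVanish H (n + 1) M H) : IsBiresolving (tensorClass k H) where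
  exists_syzygy X := by
    rintro ⟨K, M, _, _, _, _, _, _, _, _, _, _, hK, ⟨e⟩⟩
    have := hK.1
    obtain ⟨p, f, hf⟩ := Module.Finite.exists_fin' H K
    exact ⟨_, tensorClass_tensorMod M (hK.ker f hf),
      (isSyzygyOf_tensorMod_ker M f hf).congr_right e⟩
  exists_cosyzygy X := by
    rintro ⟨K, M, _, _, _, _, _, _, _, _, _, _, hK, ⟨e⟩⟩
    obtain ⟨p, f, hf, hL⟩ := hK.exists_cosyzygy φ ψ hφψ hψφ hH
    exact ⟨_, tensorClass_tensorMod M hL, (isSyzygyOf_tensorMod_quotient M f hf).congr_left e.symm⟩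

theorem hasResolution_tensorClass [IsNoetherianRing H] {n : ℕ}
    (hH : ∀ M : ModuleCat.{u} H, ExtVanish H (n + 1) M H) (X : ModuleCat.{u} H) :
    HasResolution (tensorClass k H) n X := by
  let _ := Module.compHom X (algebraMap k H)
  have : IsScalarTower k H X := ⟨fun a h x => by rw [Algebra.smul_def, mul_smul]; rfl⟩
  have : SMulCommClass k H X := IsScalarTower.to_smulCommClass
  let _ := trivModule k H
  have htriv (h : H) (c : k) : h • c = Coalgebra.counit (R := k) h * c := rfl
  have : IsScalarTower k H k := ⟨fun a h c => by simp [htriv, mul_assoc]⟩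
  have : SMulCommClass k H k := IsScalarTower.to_smulCommClass
  have : Module.Finite H k := ⟨⟨{1}, by
    refine eq_top_iff.mpr fun c _ => ?_
    rw [Finset.coe_singleton, Submodule.mem_span_singleton]
    exact ⟨algebraMap k H c, by simp [htriv]⟩⟩⟩
  exact (hasResolution_tensorMod (K := k) X n fun i hi =>
    ExtVanish.mono_right (Nat.succ_le_succ hi) hH).congr (fun _ _ => tensorClass.congr)
    (trivTensorEquiv X htriv)

end TensorClass

section Antipode

variable (k : Type u) [Field k] (H : Type u) [Ring H] [HopfAlgebra k H]

/-- The antipode, as a ring homomorphism to the opposite ring. -/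
def antipodeOp : H →+* Hᵐᵒᵖ where
  toFun h := .op (HopfAlgebra.antipode k h)
  map_one' := by simp
  map_mul' x y := by rw [HopfAlgebra.antipode_mul_antidistrib, MulOpposite.op_mul]
  map_zero' := by simp
  map_add' := by simp

/-- The inverse of a bijective antipode, as a ring homomorphism to the opposite ring. -/
noncomputable def antipodeInvOp (hS : Function.Bijective (HopfAlgebra.antipode (R := k) (A := H))) :
    H →+* Hᵐᵒᵖ :=
  let e := LinearEquiv.ofBijective _ hS
  { toFun h := .op (e.symm h)
    map_one' := congrArg _ (e.symm_apply_eq.mpr HopfAlgebra.antipode_one.symm)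
    map_mul' x y := congrArg _ <| e.symm_apply_eq.mpr <| by
      rw [LinearEquiv.ofBijective_apply, HopfAlgebra.antipode_mul_antidistrib]
      exact congrArg₂ _ (e.apply_symm_apply x).symm (e.apply_symm_apply y).symm
    map_zero' := by simp
    map_add' := by simp }

variable {k H}

theorem lGgldim_le_and_spli_le_of_injDim_le [IsNoetherianRing H]
    (hS : Function.Bijective (HopfAlgebra.antipode (R := k) (A := H))) {n : ℕ}
    (h : injDim H H ≤ n) : lGgldim H ≤ n ∧ spli H ≤ n := by
  have hH := (injDim_le_iff n H).mp h
  have hC : IsBiresolving (tensorClass k H) := isBiresolving_tensorClass (antipodeOp k H)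
    (antipodeInvOp k H hS) (LinearEquiv.ofBijective _ hS).apply_symm_apply
    (LinearEquiv.ofBijective _ hS).symm_apply_apply hH
  have hExt (X : ModuleCat.{u} H) (hX : tensorClass k H X) (Q : ModuleCat.{u} H)
      (hQ : Module.Projective H Q) : ExtVanish H 1 X Q :=
    hC.extVanish (fun M => extVanish_projective hH M Q) hX 0
  exact ⟨lGgldim_le_of_hasResolution (hC.isGorensteinProjective hExt)
      (hasResolution_tensorClass hH),
    spli_le_of_hasResolution hC hExt (hasResolution_tensorClass hH)⟩

theorem injDim_le_of_spli_le_of_antipode_bijective [IsNoetherianRing H] [IsNoetherianRing Hᵐᵒᵖ]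
    (hS : Function.Bijective (HopfAlgebra.antipode (R := k) (A := H))) {n : ℕ}
    (h : spli H ≤ n) : injDim H H ≤ n :=
  injDim_le_of_spli_le (antipodeOp k H) (antipodeInvOp k H hS)
    (LinearEquiv.ofBijective _ hS).apply_symm_apply
    (LinearEquiv.ofBijective _ hS).symm_apply_apply h

end Antipode

theorem enat_eq_of_forall_le_natCast_iff {a b : ℕ∞} (h : ∀ n : ℕ, a ≤ n ↔ b ≤ n) : a = b := by
  refine le_antisymm ?_ ?_
  · induction b with
    | top => exact le_top
    | coe n => exact (h n).mpr le_rfl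
  · induction a with
    | top => exact le_top
    | coe n => exact (h n).mp le_rfl

/-- Let `H` be a noetherian Hopf algebra over a field `k` with bijective
antipode. Then `l.Ggldim(H) = l.silp(H) = l.spli(H) = id_H(H)`, where `id_H(H)` is the
injective dimension of the left regular module. -/
theorem lGgldim_eq_silp_eq_spli_eq_injDim (k : Type u) [Field k]
    (H : Type u) [Ring H] [HopfAlgebra k H]
    [IsNoetherianRing H] [IsNoetherianRing Hᵐᵒᵖ]
    (hS : Function.Bijective (HopfAlgebra.antipode (R := k) (A := H))) :
    lGgldim H = silp H ∧ silp H = spli H ∧ spli H = injDim H H := by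
  have hG : lGgldim H = injDim H H := enat_eq_of_forall_le_natCast_iff fun n =>
    ⟨injDim_le_of_lGgldim_le, fun h => (lGgldim_le_and_spli_le_of_injDim_le hS h).1⟩
  have hP : spli H = injDim H H := enat_eq_of_forall_le_natCast_iff fun n =>
    ⟨injDim_le_of_spli_le_of_antipode_bijective hS,
      fun h => (lGgldim_le_and_spli_le_of_injDim_le hS h).2⟩
  have hI : silp H = injDim H H := enat_eq_of_forall_le_natCast_iff fun n =>
    ⟨injDim_le_silp.trans, silp_le_of_injDim_le⟩
  exact ⟨hG.trans hI.symm, hI.trans hP.symm, hP⟩
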